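/- arXiv:1909.08830 — 3 statements merged into one kernel-verified Lean document; each statement's English description precedes it below -/
import Mathlib

section
/- Let n̄ ≥ 1, λ ≥ 0, and k ∈ ℝ^n̄, and let J(u) = (1/2)·‖u − k‖₂² + λ·|∑_{i=1}^{n̄} u_i| for u ∈ ℝ^n̄. Then the minimizer of J over ℝ^n̄ is: k + λ·𝟙 if ∑_i k_i < −n̄λ; k − ((∑_i k_i)/n̄)·𝟙 if −n̄λ ≤ ∑_i k_i ≤ n̄λ; and k − λ·𝟙 if ∑_i k_i > n̄λ, where 𝟙 ∈ ℝ^n̄ is the all-ones vector. That is, for every u ∈ ℝ^n̄, J(u) ≥ J of the stated point. -/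
/-- If `c` is `lam` times a subgradient of the absolute value at `∑ i, (k i - c)`, then the
constant shift of `k` by `-c` minimizes `u ↦ (1/2)‖u - k‖₂² + lam * |∑ i, u i|`. -/
theorem half_sum_sq_add_abs_sum_le_of_subgradient {ι : Type*} [Fintype ι] {lam c : ℝ}
    {k : ι → ℝ} (hc : |c| ≤ lam)
    (hsub : lam * |∑ i, (k i - c)| = c * ∑ i, (k i - c)) (u : ι → ℝ) :
    (1 / 2) * (∑ i, (k i - c - k i) ^ 2) + lam * |∑ i, (k i - c)| ≤
      (1 / 2) * (∑ i, (u i - k i) ^ 2) + lam * |∑ i, u i| := by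
  have hsq : ∑ i, ((k i - c - k i) ^ 2 - 2 * c * (u i - (k i - c))) ≤ ∑ i, (u i - k i) ^ 2 :=
    Finset.sum_le_sum fun i _ => by nlinarith [sq_nonneg (u i - k i + c)]
  have habs : c * ∑ i, u i ≤ lam * |∑ i, u i| :=
    (le_abs_self _).trans <| by
      rw [abs_mul]
      exact mul_le_mul_of_nonneg_right hc (abs_nonneg _)
  rw [Finset.sum_sub_distrib, ← Finset.mul_sum,
    Finset.sum_sub_distrib (f := u) (g := fun i => k i - c)] at hsq
  rw [hsub]
  linarith

/-- Lemma 2 of the paper: the closed form of the proximal operator of the Absum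
regularizer.  For `J u = (1/2)‖u - k‖₂² + λ|∑ i, u i|`, the point
`k + λ𝟙`, `k - ((∑ i, k i)/n̄)𝟙`, or `k - λ𝟙` (according to the three cases on
`∑ i, k i`) minimizes `J` over `ℝ^n̄`. -/
theorem absum_prox_closed_form (n : ℕ) (hn : 1 ≤ n) (lam : ℝ) (hlam : 0 ≤ lam)
    (k : Fin n → ℝ) (J : (Fin n → ℝ) → ℝ)
    (hJ : ∀ u : Fin n → ℝ, J u = (1 / 2) * (∑ i, (u i - k i) ^ 2) + lam * |∑ i, u i|)
    (ustar : Fin n → ℝ)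
    (hstar : ustar =
      if (∑ i, k i) < -((n : ℝ) * lam) then (fun i => k i + lam)
      else if (∑ i, k i) ≤ (n : ℝ) * lam then (fun i => k i - (∑ j, k j) / (n : ℝ))
      else (fun i => k i - lam)) :
    ∀ u : Fin n → ℝ, J u ≥ J ustar := by
  intro u
  have hn' : (0 : ℝ) < n := by exact_mod_cast hn
  have hsum (c : ℝ) : ∑ i, (k i - c) = ∑ i, k i - n * c := by
    simp [Finset.sum_sub_distrib]
  obtain ⟨c, hc, hsub, rfl⟩ : ∃ c : ℝ, |c| ≤ lam ∧
      lam * |∑ i, (k i - c)| = c * ∑ i, (k i - c) ∧ ustar = fun i => k i - c := by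
    split_ifs at hstar with h₁ h₂
    · refine ⟨-lam, by rw [abs_neg, abs_of_nonneg hlam], ?_, by simpa using hstar⟩
      rw [hsum, abs_of_nonpos (by linarith)]
      ring
    · refine ⟨(∑ j, k j) / n, ?_, ?_, hstar⟩
      · rw [abs_le, le_div_iff₀ hn', div_le_iff₀ hn']
        constructor <;> linarith
      · rw [hsum, mul_div_cancel₀ _ hn'.ne']
        simp
    · refine ⟨lam, (abs_of_nonneg hlam).le, ?_, hstar⟩
      rw [hsum, abs_of_nonneg (by linarith)]
  rw [hJ, hJ]
  exact half_sum_sq_add_abs_sum_le_of_subgradient hc hsub u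
end

section
/- Let n̄ ≥ 1, λ ≥ 0, and k ∈ ℝ^n̄ with ∑_{i=1}^{n̄} k_i < −n̄λ. Then u* = k + λ·𝟙 satisfies ∑_i u*_i < 0, and for every u ∈ ℝ^n̄ with ∑_i u_i < 0 one has (1/2)‖u − k‖₂² − λ·∑_i u_i ≥ (1/2)‖u* − k‖₂² − λ·∑_i u*_i. -/
/-- Case (b) of the proof of Lemma 2: when `∑ i, k i < -n̄λ`, the point
`u* = k + λ𝟙` has negative coordinate sum and minimizes
`(1/2)‖u - k‖₂² - λ∑ i, u i` over all `u` with negative coordinate sum. -/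
theorem absum_prox_case_neg (n : ℕ) (hn : 1 ≤ n) (lam : ℝ) (hlam : 0 ≤ lam)
    (k : Fin n → ℝ) (hk : (∑ i, k i) < -((n : ℝ) * lam))
    (ustar : Fin n → ℝ) (hstar : ustar = fun i => k i + lam) :
    (∑ i, ustar i) < 0 ∧
      ∀ u : Fin n → ℝ, (∑ i, u i) < 0 →
        (1 / 2) * (∑ i, (u i - k i) ^ 2) - lam * (∑ i, u i) ≥
          (1 / 2) * (∑ i, (ustar i - k i) ^ 2) - lam * (∑ i, ustar i) := by
  subst hstar
  refine ⟨?_, fun u _ => ?_⟩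
  · simp only [Finset.sum_add_distrib, Finset.sum_const, Finset.card_univ, Fintype.card_fin,
      nsmul_eq_mul]
    linarith
  · simp only [Finset.mul_sum, ← Finset.sum_sub_distrib]
    refine Finset.sum_le_sum fun i _ => ?_
    nlinarith [sq_nonneg (u i - k i - lam)]
end

section
/- Let n̄ ≥ 1, λ ≥ 0, and k ∈ ℝ^n̄ with |∑_{i=1}^{n̄} k_i| ≤ n̄λ. Then u* = k − ((∑_i k_i)/n̄)·𝟙 satisfies ∑_i u*_i = 0, and for every u ∈ ℝ^n̄ one has (1/2)‖u − k‖₂² + λ·|∑_i u_i| ≥ (1/2)‖u* − k‖₂². -/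
/-- Case (c) of the proof of Lemma 2: when `|∑ i, k i| ≤ n̄λ`, the point
`u* = k - ((∑ i, k i)/n̄)𝟙` has zero coordinate sum and minimizes
`(1/2)‖u - k‖₂² + λ|∑ i, u i|` over all of `ℝ^n̄`. -/
theorem absum_prox_case_zero (n : ℕ) (hn : 1 ≤ n) (lam : ℝ) (hlam : 0 ≤ lam)
    (k : Fin n → ℝ) (hk : |∑ i, k i| ≤ (n : ℝ) * lam)
    (ustar : Fin n → ℝ) (hstar : ustar = fun i => k i - (∑ j, k j) / (n : ℝ)) :
    (∑ i, ustar i) = 0 ∧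
      ∀ u : Fin n → ℝ,
        (1 / 2) * (∑ i, (u i - k i) ^ 2) + lam * |∑ i, u i| ≥
          (1 / 2) * (∑ i, (ustar i - k i) ^ 2) := by
  subst hstar
  have hn0 : (0 : ℝ) < n := by exact_mod_cast hn
  set m : ℝ := (∑ j, k j) / (n : ℝ) with hm
  have hsum : ∑ j, k j = n * m := by rw [hm]; field_simp
  have hmlam : |m| ≤ lam := by
    rw [hsum, abs_mul, abs_of_pos hn0] at hk
    exact le_of_mul_le_mul_left hk hn0
  refine ⟨by simp [Finset.sum_sub_distrib, hsum], fun u => ?_⟩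
  have htangent : ∑ i, (-2 * m * (u i - k i) - m ^ 2) ≤ ∑ i, (u i - k i) ^ 2 :=
    Finset.sum_le_sum fun i _ => by nlinarith [sq_nonneg (u i - k i + m)]
  have hdual : m * ∑ i, u i ≤ lam * |∑ i, u i| :=
    (le_abs_self _).trans <| by rw [abs_mul]; gcongr
  have hstar : ∑ i, (k i - m - k i) ^ 2 = n * m ^ 2 := by simp
  rw [Finset.sum_sub_distrib, ← Finset.mul_sum, Finset.sum_sub_distrib, hsum] at htangent
  simp only [Finset.sum_const, Finset.card_univ, Fintype.card_fin, nsmul_eq_mul] at htangent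
  rw [hstar]
  linarith
end
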